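/- For any Markov chain X–Y–Z one has ρ_m(X;Z) ≤ ρ_m(X;Y)·ρ_m(Y;Z); moreover the supremum of ρ_m(X;Z)/ρ_m(Y;Z) over all Z forming a Markov chain X–Y–Z with ρ_m(Y;Z) ≠ 0 equals ρ_m(X;Y). In particular, for the backward channel Z = X' with conditional law P_{X'|Y} = P_{X|Y} (so P_{X'Y} = P_{XY} and X–Y–X' is Markov), ρ_m(X;X') = ρ_m²(X;Y). -/

import Mathlib

open scoped BigOperators

noncomputable section

namespace RatePrivacy

variable {α β γ : Type*}

/-- `p` is a probability mass function on a finite alphabet. -/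
def IsPMF [Fintype α] (p : α → ℝ) : Prop := (∀ a, 0 ≤ p a) ∧ ∑ a, p a = 1

/-- Shannon entropy (in bits) of the distribution `p`. -/
def ent [Fintype α] (p : α → ℝ) : ℝ := ∑ a, -(p a * Real.logb 2 (p a))

/-- First marginal of a joint distribution. -/
def margA [Fintype α] [Fintype β] (p : α × β → ℝ) : α → ℝ := fun a => ∑ b, p (a, b)

/-- Second marginal of a joint distribution. -/
def margB [Fintype α] [Fintype β] (p : α × β → ℝ) : β → ℝ := fun b => ∑ a, p (a, b)

/-- Mutual information (in bits) of a joint distribution `p`: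
`I(A;B) = H(A) + H(B) - H(A,B)`. -/
def mi [Fintype α] [Fintype β] (p : α × β → ℝ) : ℝ :=
  ent (margA p) + ent (margB p) - ent p

/-- `q` is a (row-stochastic) channel. -/
def IsChannel [Fintype γ] (q : β → γ → ℝ) : Prop :=
  (∀ y z, 0 ≤ q y z) ∧ ∀ y, ∑ z, q y z = 1

/-- Joint distribution of `(X, Z)` when `Z` is obtained from `Y` through the channel `q`
(so that `X — Y — Z` is a Markov chain). -/
def jointXZ [Fintype α] [Fintype β] [Fintype γ] (p : α × β → ℝ) (q : β → γ → ℝ) :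
    α × γ → ℝ := fun xz => ∑ y, p (xz.1, y) * q y xz.2

/-- Joint distribution of `(Y, Z)` when `Z` is obtained from `Y` through the channel `q`. -/
def jointYZ [Fintype α] [Fintype β] [Fintype γ] (p : α × β → ℝ) (q : β → γ → ℝ) :
    β × γ → ℝ := fun yz => margB p yz.1 * q yz.1 yz.2

/-- Achievable rates `I(Y;Z)` over all privacy filters `Z` (on finite alphabets, wlog `Fin n`)
with `X — Y — Z` Markov and `I(X;Z) ≤ ε`. -/
def gSet [Fintype α] [Fintype β] (p : α × β → ℝ) (ε : ℝ) : Set ℝ :=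
  { r | ∃ (n : ℕ) (q : β → Fin n → ℝ), IsChannel q ∧
        mi (jointXZ p q) ≤ ε ∧ r = mi (jointYZ p q) }

/-- The rate-privacy function `g_ε(X;Y)` (privacy measured by mutual information). -/
def g [Fintype α] [Fintype β] (p : α × β → ℝ) (ε : ℝ) : ℝ := sSup (gSet p ε)

/-- Values `E[f(A) g(B)]` over all zero-mean unit-variance `f, g`, used to define
the Hirschfeld–Gebelein–Rényi maximal correlation. -/
def corrSet [Fintype α] [Fintype β] (p : α × β → ℝ) : Set ℝ :=
  { r | ∃ (f : α → ℝ) (g : β → ℝ),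
      (∑ a, margA p a * f a = 0) ∧ (∑ b, margB p b * g b = 0) ∧
      (∑ a, margA p a * (f a) ^ 2 = 1) ∧ (∑ b, margB p b * (g b) ^ 2 = 1) ∧
      r = ∑ x : α × β, p x * (f x.1 * g x.2) }

/-- Maximal correlation `ρ_m(A;B)` (equal to `0` when the constraint set is empty,
since `sSup ∅ = 0` in `ℝ`). -/
def rhoM [Fintype α] [Fintype β] (p : α × β → ℝ) : ℝ := sSup (corrSet p)

/-- Achievable rates with maximal-correlation privacy constraint `ρ_m²(X;Z) ≤ ε`. -/
def ghSet [Fintype α] [Fintype β] (p : α × β → ℝ) (ε : ℝ) : Set ℝ :=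
  { r | ∃ (n : ℕ) (q : β → Fin n → ℝ), IsChannel q ∧
        (rhoM (jointXZ p q)) ^ 2 ≤ ε ∧ r = mi (jointYZ p q) }

/-- The rate-privacy function `ĝ_ε(X;Y)` (privacy measured by squared maximal correlation). -/
def gh [Fintype α] [Fintype β] (p : α × β → ℝ) (ε : ℝ) : ℝ := sSup (ghSet p ε)

/-- The Kullback–Leibler divergence (in bits) `D(P_{X|Y}(·|y) ‖ P_X)`. -/
def Dxy [Fintype α] [Fintype β] (p : α × β → ℝ) (y : β) : ℝ :=
  ∑ x, (p (x, y) / margB p y) * Real.logb 2 ((p (x, y) / margB p y) / margA p x)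

theorem sum_mul_fst [Fintype α] [Fintype β] (p : α × β → ℝ) (f : α → ℝ) :
    ∑ x : α × β, p x * f x.1 = ∑ a, margA p a * f a := by
  simp [Fintype.sum_prod_type, margA, Finset.sum_mul]

theorem sum_mul_snd [Fintype α] [Fintype β] (p : α × β → ℝ) (g : β → ℝ) :
    ∑ x : α × β, p x * g x.2 = ∑ b, margB p b * g b := by
  simp [Fintype.sum_prod_type_right, margB, Finset.sum_mul]

theorem margA_nonneg [Fintype α] [Fintype β] {p : α × β → ℝ} (hp : ∀ x, 0 ≤ p x) (a : α) :
    0 ≤ margA p a :=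
  Finset.sum_nonneg fun _ _ => hp _

theorem margB_nonneg [Fintype α] [Fintype β] {p : α × β → ℝ} (hp : ∀ x, 0 ≤ p x) (b : β) :
    0 ≤ margB p b :=
  Finset.sum_nonneg fun _ _ => hp _

/-- The Cauchy–Schwarz inequality for `E[f(A) g(B)]`. -/
theorem sq_sum_mul_le [Fintype α] [Fintype β] {p : α × β → ℝ} (hp : ∀ x, 0 ≤ p x)
    (f : α → ℝ) (g : β → ℝ) :
    (∑ x : α × β, p x * (f x.1 * g x.2)) ^ 2 ≤
      (∑ a, margA p a * f a ^ 2) * ∑ b, margB p b * g b ^ 2 := by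
  rw [← sum_mul_fst p (fun a => f a ^ 2), ← sum_mul_snd p (fun b => g b ^ 2)]
  exact Finset.sum_sq_le_sum_mul_sum_of_sq_le_mul _
    (fun x _ => mul_nonneg (hp x) (sq_nonneg _)) (fun x _ => mul_nonneg (hp x) (sq_nonneg _))
    (fun x _ => (by ring : _ = _).le)

theorem bddAbove_corrSet [Fintype α] [Fintype β] {p : α × β → ℝ} (hp : ∀ x, 0 ≤ p x) :
    BddAbove (corrSet p) := by
  refine ⟨1, ?_⟩
  rintro r ⟨f, g, -, -, hf, hg, rfl⟩
  have h := sq_sum_mul_le hp f g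
  rw [hf, hg, one_mul] at h
  exact (abs_le_one_iff_mul_self_le_one.mpr (by rwa [← sq])).trans' (le_abs_self _)

theorem rhoM_nonneg [Fintype α] [Fintype β] (p : α × β → ℝ) : 0 ≤ rhoM p := by
  rcases (corrSet p).eq_empty_or_nonempty with h | ⟨r, f, g, hf, hg, hf2, hg2, rfl⟩
  · simp [rhoM, h]
  · apply Real.sSup_nonneg'
    rcases le_total 0 (∑ x : α × β, p x * (f x.1 * g x.2)) with h | h
    · exact ⟨_, ⟨f, g, hf, hg, hf2, hg2, rfl⟩, h⟩
    · refine ⟨_, ⟨fun a => -f a, g, ?_, hg, ?_, hg2, rfl⟩, ?_⟩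
      · simp [hf]
      · simpa using hf2
      · simpa using h

/-- The bilinear form `E[f(A) g(B)]` on centred functions is bounded by `ρ_m(A;B) ‖f‖ ‖g‖`. -/
theorem sum_mul_le_rhoM [Fintype α] [Fintype β] {p : α × β → ℝ} (hp : ∀ x, 0 ≤ p x)
    {f : α → ℝ} {g : β → ℝ} (hf : ∑ a, margA p a * f a = 0) (hg : ∑ b, margB p b * g b = 0) :
    ∑ x : α × β, p x * (f x.1 * g x.2) ≤
      rhoM p * (√(∑ a, margA p a * f a ^ 2) * √(∑ b, margB p b * g b ^ 2)) := by
  have hA : 0 ≤ ∑ a, margA p a * f a ^ 2 :=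
    Finset.sum_nonneg fun a _ => mul_nonneg (margA_nonneg hp a) (sq_nonneg _)
  have hB : 0 ≤ ∑ b, margB p b * g b ^ 2 :=
    Finset.sum_nonneg fun b _ => mul_nonneg (margB_nonneg hp b) (sq_nonneg _)
  have hCS := sq_sum_mul_le hp f g
  set A := ∑ a, margA p a * f a ^ 2 with hAdef
  set B := ∑ b, margB p b * g b ^ 2 with hBdef
  rcases (mul_nonneg hA hB).eq_or_lt with h0 | h0
  · rw [← h0] at hCS
    rw [← Real.sqrt_mul hA, ← h0, pow_eq_zero_iff two_ne_zero |>.mp (hCS.antisymm (sq_nonneg _))]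
    simp
  · have hApos : 0 < A := pos_of_mul_pos_left h0 hB
    have hBpos : 0 < B := pos_of_mul_pos_right h0 hA
    have hsA := Real.sqrt_pos.mpr hApos
    have hsB := Real.sqrt_pos.mpr hBpos
    rw [← div_le_iff₀ (mul_pos hsA hsB)]
    refine le_csSup (bddAbove_corrSet hp)
      ⟨fun a => f a / √A, fun b => g b / √B, ?_, ?_, ?_, ?_, ?_⟩
    · simp only [← mul_div_assoc, ← Finset.sum_div, hf, zero_div]
    · simp only [← mul_div_assoc, ← Finset.sum_div, hg, zero_div]
    · simp only [div_pow, ← mul_div_assoc, ← Finset.sum_div, Real.sq_sqrt hA, ← hAdef]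
      exact div_self hApos.ne'
    · simp only [div_pow, ← mul_div_assoc, ← Finset.sum_div, Real.sq_sqrt hB, ← hBdef]
      exact div_self hBpos.ne'
    · rw [Finset.sum_div]
      exact Finset.sum_congr rfl fun x _ => by rw [div_mul_div_comm, mul_div_assoc]

theorem rhoM_comp_equiv_le {α' β' : Type*} [Fintype α] [Fintype β] [Fintype α'] [Fintype β']
    {p : α × β → ℝ} (hp : ∀ x, 0 ≤ p x) (e : α' ≃ α) (e' : β' ≃ β) :
    rhoM (fun x : α' × β' => p (e x.1, e' x.2)) ≤ rhoM p := by
  have hA : ∀ a, margA (fun x : α' × β' => p (e x.1, e' x.2)) a = margA p (e a) := fun a =>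
    e'.sum_comp fun b => p (e a, b)
  have hB : ∀ b, margB (fun x : α' × β' => p (e x.1, e' x.2)) b = margB p (e' b) := fun b =>
    e.sum_comp fun a => p (a, e' b)
  refine Real.sSup_le ?_ (rhoM_nonneg p)
  rintro r ⟨f, g, hf, hg, hf2, hg2, rfl⟩
  simp only [hA, hB] at hf hg hf2 hg2
  refine le_csSup (bddAbove_corrSet hp) ⟨f ∘ e.symm, g ∘ e'.symm, ?_, ?_, ?_, ?_, ?_⟩
  · rw [← hf, ← e.sum_comp]; simp
  · rw [← hg, ← e'.sum_comp]; simp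
  · rw [← hf2, ← e.sum_comp]; simp
  · rw [← hg2, ← e'.sum_comp]; simp
  · rw [← (e.prodCongr e').sum_comp]; simp [Prod.map]

theorem rhoM_comp_equiv {α' β' : Type*} [Fintype α] [Fintype β] [Fintype α'] [Fintype β']
    {p : α × β → ℝ} (hp : ∀ x, 0 ≤ p x) (e : α' ≃ α) (e' : β' ≃ β) :
    rhoM (fun x : α' × β' => p (e x.1, e' x.2)) = rhoM p := by
  refine le_antisymm (rhoM_comp_equiv_le hp e e') ?_
  simpa using rhoM_comp_equiv_le (p := fun x : α' × β' => p (e x.1, e' x.2))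
    (fun _ => hp _) e.symm e'.symm

theorem corrSet_swap_subset [Fintype α] [Fintype β] (p : α × β → ℝ) :
    corrSet (fun x : β × α => p x.swap) ⊆ corrSet p := by
  rintro r ⟨f, g, hf, hg, hf2, hg2, rfl⟩
  refine ⟨g, f, hg, hf, hg2, hf2, ?_⟩
  rw [← (Equiv.prodComm β α).sum_comp]
  simp [mul_comm]

theorem rhoM_swap [Fintype α] [Fintype β] (p : α × β → ℝ) :
    rhoM (fun x : β × α => p x.swap) = rhoM p :=
  congrArg sSup ((corrSet_swap_subset p).antisymm
    (corrSet_swap_subset fun x : β × α => p x.swap))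

section Markov

variable [Fintype α] [Fintype β] [Fintype γ] {p : α × β → ℝ} {q : β → γ → ℝ}

theorem jointXZ_nonneg (hp : ∀ x, 0 ≤ p x) (hq : IsChannel q) (x : α × γ) :
    0 ≤ jointXZ p q x :=
  Finset.sum_nonneg fun _ _ => mul_nonneg (hp _) (hq.1 _ _)

theorem jointYZ_nonneg (hp : ∀ x, 0 ≤ p x) (hq : IsChannel q) (x : β × γ) :
    0 ≤ jointYZ p q x :=
  mul_nonneg (margB_nonneg hp _) (hq.1 _ _)

theorem margA_jointXZ (hq : IsChannel q) : margA (jointXZ p q) = margA p := by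
  ext a
  simp only [margA, jointXZ]
  rw [Finset.sum_comm]
  simp [← Finset.mul_sum, hq.2]

theorem margA_jointYZ (hq : IsChannel q) : margA (jointYZ p q) = margB p := by
  ext b
  simp [margA, jointYZ, ← Finset.mul_sum, hq.2]

theorem margB_jointXZ : margB (jointXZ p q) = margB (jointYZ p q) := by
  ext c
  simp only [margB, jointXZ, jointYZ]
  rw [Finset.sum_comm]
  simp [← Finset.sum_mul]

/-- The conditional expectation `E[f(A) | B]`. -/
def condExpB (p : α × β → ℝ) (f : α → ℝ) : β → ℝ := fun b => (∑ a, p (a, b) * f a) / margB p b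

theorem margB_mul_condExpB (hpos : ∀ b, 0 < margB p b) (f : α → ℝ) (b : β) :
    margB p b * condExpB p f b = ∑ a, p (a, b) * f a :=
  mul_div_cancel₀ _ (hpos b).ne'

theorem sum_condExpB (hpos : ∀ b, 0 < margB p b) (f : α → ℝ) :
    ∑ b, margB p b * condExpB p f b = ∑ a, margA p a * f a := by
  simp only [margB_mul_condExpB hpos]
  rw [← sum_mul_fst, Fintype.sum_prod_type_right]

theorem sum_mul_eq_sum_condExpB (hpos : ∀ b, 0 < margB p b) (f : α → ℝ) (g : β → ℝ) :
    ∑ x : α × β, p x * (f x.1 * g x.2) = ∑ b, margB p b * (condExpB p f b * g b) := by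
  simp only [← mul_assoc, margB_mul_condExpB hpos, Fintype.sum_prod_type_right, Finset.sum_mul]

theorem sum_jointXZ (hpos : ∀ b, 0 < margB p b) (f : α → ℝ) (h : γ → ℝ) :
    ∑ x : α × γ, jointXZ p q x * (f x.1 * h x.2) =
      ∑ b, margB p b * (condExpB p f b * ∑ c, q b c * h c) := by
  simp only [← mul_assoc (margB p _), margB_mul_condExpB hpos, Finset.sum_mul_sum]
  rw [Finset.sum_comm, Fintype.sum_prod_type]
  refine Finset.sum_congr rfl fun a _ => ?_
  rw [Finset.sum_comm]
  refine Finset.sum_congr rfl fun c _ => ?_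
  rw [jointXZ, Finset.sum_mul]
  exact Finset.sum_congr rfl fun b _ => by ring

theorem norm_condExpB_le (hp : ∀ x, 0 ≤ p x) (hpos : ∀ b, 0 < margB p b) {f : α → ℝ}
    (hf : ∑ a, margA p a * f a = 0) :
    √(∑ b, margB p b * condExpB p f b ^ 2) ≤ rhoM p * √(∑ a, margA p a * f a ^ 2) := by
  have h := sum_mul_le_rhoM hp hf ((sum_condExpB hpos f).trans hf)
  rw [sum_mul_eq_sum_condExpB hpos] at h
  simp only [← sq] at h
  have h0 : 0 ≤ ∑ b, margB p b * condExpB p f b ^ 2 :=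
    Finset.sum_nonneg fun b _ => mul_nonneg (hpos b).le (sq_nonneg _)
  rcases h0.eq_or_lt with h0 | h0
  · rw [← h0, Real.sqrt_zero]
    exact mul_nonneg (rhoM_nonneg p) (Real.sqrt_nonneg _)
  · have hs := Real.sqrt_pos.mpr h0
    refine le_of_mul_le_mul_right ?_ hs
    rwa [Real.mul_self_sqrt h0.le, mul_assoc]

/-- The product form of the data processing inequality for maximal correlation. -/
theorem rhoM_jointXZ_le (hp : ∀ x, 0 ≤ p x) (hpos : ∀ b, 0 < margB p b) (hq : IsChannel q) :
    rhoM (jointXZ p q) ≤ rhoM p * rhoM (jointYZ p q) := by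
  refine Real.sSup_le ?_ (mul_nonneg (rhoM_nonneg _) (rhoM_nonneg _))
  rintro r ⟨f, h, hf, hh, hf2, hh2, rfl⟩
  rw [margA_jointXZ hq] at hf hf2
  rw [margB_jointXZ] at hh hh2
  set w : β → ℝ := fun b => ∑ c, q b c * h c with hw
  have hYZ : ∀ u : β → ℝ, ∑ x : β × γ, jointYZ p q x * (u x.1 * h x.2) =
      ∑ b, margB p b * (u b * w b) := by
    intro u
    simp only [Fintype.sum_prod_type, jointYZ, hw, Finset.mul_sum]
    exact Finset.sum_congr rfl fun b _ => Finset.sum_congr rfl fun c _ => by ring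
  have hu0 := (sum_condExpB hpos f).trans hf
  have hu := norm_condExpB_le hp hpos hf
  rw [sum_jointXZ hpos, ← hYZ]
  have key := sum_mul_le_rhoM (jointYZ_nonneg hp hq) (f := condExpB p f) (g := h)
    (by rwa [margA_jointYZ hq]) hh
  rw [margA_jointYZ hq, hh2, Real.sqrt_one, mul_one] at key
  rw [hf2, Real.sqrt_one, mul_one] at hu
  rw [mul_comm (rhoM p)]
  exact key.trans (mul_le_mul_of_nonneg_left hu (rhoM_nonneg _))

theorem isChannel_backward (hp : ∀ x, 0 ≤ p x) (hpos : ∀ b, 0 < margB p b) (e : γ ≃ α) :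
    IsChannel fun b c => p (e c, b) / margB p b := by
  refine ⟨fun b c => div_nonneg (hp _) (hpos b).le, fun b => ?_⟩
  rw [← Finset.sum_div, e.sum_comp fun a => p (a, b)]
  exact div_self (hpos b).ne'

theorem jointYZ_backward (hpos : ∀ b, 0 < margB p b) (e : γ ≃ α) :
    jointYZ p (fun b c => p (e c, b) / margB p b) = fun x => p (e x.2, x.1) := by
  ext x
  exact mul_div_cancel₀ _ (hpos _).ne'

theorem rhoM_jointYZ_backward (hp : ∀ x, 0 ≤ p x) (hpos : ∀ b, 0 < margB p b) (e : γ ≃ α) :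
    rhoM (jointYZ p fun b c => p (e c, b) / margB p b) = rhoM p := by
  rw [jointYZ_backward hpos, ← rhoM_swap p]
  exact rhoM_comp_equiv (p := fun x : β × α => p x.swap) (fun _ => hp _) (Equiv.refl β) e

/-- The backward channel, with output relabelled through `e`, squares the maximal correlation. -/
theorem rhoM_jointXZ_backward (hp : ∀ x, 0 ≤ p x) (hpos : ∀ b, 0 < margB p b) (e : γ ≃ α) :
    rhoM (jointXZ p fun b c => p (e c, b) / margB p b) = rhoM p ^ 2 := by
  have hq := isChannel_backward hp hpos e
  refine le_antisymm ?_ ?_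
  · have h := rhoM_jointXZ_le hp hpos hq
    rwa [rhoM_jointYZ_backward hp hpos, ← sq] at h
  have hM : ∀ c, margB (jointXZ p fun b c => p (e c, b) / margB p b) c = margA p (e c) := by
    intro c
    rw [margB_jointXZ, jointYZ_backward hpos]
    rfl
  rw [← Real.le_sqrt (rhoM_nonneg _) (rhoM_nonneg _)]
  refine Real.sSup_le ?_ (Real.sqrt_nonneg _)
  rintro r ⟨f, g, hf, hg, hf2, hg2, rfl⟩
  apply Real.le_sqrt_of_sq_le
  have hcs := Finset.sum_sq_le_sum_mul_sum_of_sq_le_mul Finset.univ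
    (r := fun b => margB p b * (condExpB p f b * g b))
    (f := fun b => margB p b * condExpB p f b ^ 2) (g := fun b => margB p b * g b ^ 2)
    (fun b _ => mul_nonneg (hpos b).le (sq_nonneg _))
    (fun b _ => mul_nonneg (hpos b).le (sq_nonneg _)) (fun b _ => (by ring : _ = _).le)
  rw [hg2, mul_one, ← sum_mul_eq_sum_condExpB hpos] at hcs
  refine hcs.trans (le_csSup (bddAbove_corrSet (jointXZ_nonneg hp hq))
    ⟨f, f ∘ e, ?_, ?_, ?_, ?_, ?_⟩)
  · rwa [margA_jointXZ hq]
  · simp only [hM]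
    exact (e.sum_comp fun a => margA p a * f a).trans hf
  · rwa [margA_jointXZ hq]
  · simp only [hM]
    exact (e.sum_comp fun a => margA p a * f a ^ 2).trans hf2
  · rw [sum_jointXZ hpos]
    refine Finset.sum_congr rfl fun b _ => ?_
    rw [sq]
    congr 2
    simp only [condExpB, Function.comp_apply, div_mul_eq_mul_div, ← Finset.sum_div]
    rw [e.sum_comp fun a => p (a, b) * f a]

end Markov

/-- (a) For any Markov chain `X — Y — Z` (i.e. `Z` obtained from `Y` via a
channel `q`), `ρ_m(X;Z) ≤ ρ_m(X;Y)·ρ_m(Y;Z)`.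
(b) The supremum of `ρ_m(X;Z)/ρ_m(Y;Z)` over all such `Z` with `ρ_m(Y;Z) ≠ 0` equals
`ρ_m(X;Y)`.
(c) For the backward channel `Z = X'` with `P_{X'|Y} = P_{X|Y}`,
`ρ_m(X;X') = ρ_m²(X;Y)`. -/
theorem stmt3 {𝓧 𝓨 : Type*} [Fintype 𝓧] [Fintype 𝓨]
    (p : 𝓧 × 𝓨 → ℝ) (hp : IsPMF p) (hYpos : ∀ y, 0 < margB p y) :
    (∀ (n : ℕ) (q : 𝓨 → Fin n → ℝ), IsChannel q →
        rhoM (jointXZ p q) ≤ rhoM p * rhoM (jointYZ p q)) ∧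
    sSup { r | ∃ (n : ℕ) (q : 𝓨 → Fin n → ℝ), IsChannel q ∧
        rhoM (jointYZ p q) ≠ 0 ∧ r = rhoM (jointXZ p q) / rhoM (jointYZ p q) }
      = rhoM p ∧
    rhoM (jointXZ p (fun y x => p (x, y) / margB p y)) = (rhoM p) ^ 2 := by
  have hp0 := hp.1
  refine ⟨fun n q hq => rhoM_jointXZ_le hp0 hYpos hq, ?_,
    rhoM_jointXZ_backward hp0 hYpos (Equiv.refl 𝓧)⟩
  have hle : ∀ r ∈ { r | ∃ (n : ℕ) (q : 𝓨 → Fin n → ℝ), IsChannel q ∧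
      rhoM (jointYZ p q) ≠ 0 ∧ r = rhoM (jointXZ p q) / rhoM (jointYZ p q) }, r ≤ rhoM p := by
    rintro r ⟨n, q, hq, h0, rfl⟩
    rw [div_le_iff₀ ((rhoM_nonneg _).lt_of_ne' h0)]
    exact rhoM_jointXZ_le hp0 hYpos hq
  refine le_antisymm (Real.sSup_le hle (rhoM_nonneg p)) ?_
  by_cases h0 : rhoM p = 0
  · rw [h0]
    refine Real.sSup_nonneg ?_
    rintro r ⟨n, q, -, -, rfl⟩
    exact div_nonneg (rhoM_nonneg _) (rhoM_nonneg _)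
  · let e := (Fintype.equivFin 𝓧).symm
    refine le_csSup ⟨_, hle⟩ ⟨_, _, isChannel_backward hp0 hYpos e, ?_, ?_⟩
    · rwa [rhoM_jointYZ_backward hp0 hYpos]
    · rw [rhoM_jointYZ_backward hp0 hYpos, rhoM_jointXZ_backward hp0 hYpos, sq,
        mul_div_cancel_right₀ _ h0]

end RatePrivacy
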